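/- arXiv:2501.13605 — 3 statements merged into one kernel-verified Lean document; each statement's English description precedes it below -/
import Mathlib

section
/- In the alternating group A_n for n ∈ {6,7,8}, the conjugacy class of an element x of cycle type (4,2) (a 4-cycle times a disjoint transposition) has size divisible by every prime dividing |A_n|. -/
/-- If an even permutation has a cycle of even length, its conjugacy class in the symmetric group
is a single conjugacy class of the alternating group. -/
theorem alternatingGroup.isConj_of_even_mem_cycleType {α : Type*} [Fintype α] [DecidableEq α]
    {σ τ : alternatingGroup α} (hc : IsConj (σ : Equiv.Perm α) (τ : Equiv.Perm α))
    {k : ℕ} (hk : k ∈ (σ : Equiv.Perm α).cycleType) (he : Even k) : IsConj σ τ := by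
  obtain ⟨π, hπ⟩ := isConj_iff.1 hc
  rcases Int.units_eq_one_or (Equiv.Perm.sign π) with h | h
  · exact isConj_iff.2 ⟨⟨π, Equiv.Perm.mem_alternatingGroup.2 h⟩, Subtype.ext hπ⟩
  · rw [Equiv.Perm.cycleType_def, Multiset.mem_map] at hk
    obtain ⟨c, hcσ, hck⟩ := hk
    replace hck : c.support.card = k := hck
    have hsign : Equiv.Perm.sign c = -1 := by
      rw [(Equiv.Perm.mem_cycleFactorsFinset_iff.1 hcσ).1.sign, hck, he.neg_one_pow]
    have hcomm : c * (σ : Equiv.Perm α) * c⁻¹ = σ :=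
      (Equiv.Perm.self_mem_cycle_factors_commute hcσ).mul_inv_cancel
    refine isConj_iff.2 ⟨⟨π * c, Equiv.Perm.mem_alternatingGroup.2 (by simp [h, hsign])⟩,
      Subtype.ext ?_⟩
    calc π * c * (σ : Equiv.Perm α) * (π * c)⁻¹
        = π * (c * (σ : Equiv.Perm α) * c⁻¹) * π⁻¹ := by group
      _ = τ := by rw [hcomm, hπ]

/-- The conjugacy class of an even permutation with a cycle of even length consists of all even
permutations of the same cycle type. -/
theorem alternatingGroup.orbit_conjAct_eq_of_even_mem_cycleType {α : Type*} [Fintype α]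
    [DecidableEq α] {σ : alternatingGroup α} {k : ℕ}
    (hk : k ∈ (σ : Equiv.Perm α).cycleType) (he : Even k) :
    MulAction.orbit (ConjAct (alternatingGroup α)) σ =
    {g : alternatingGroup α | (g : Equiv.Perm α).cycleType = (σ : Equiv.Perm α).cycleType} := by
  ext g
  rw [ConjAct.mem_orbit_conjAct, Set.mem_ofPred_eq, ← Equiv.Perm.isConj_iff_cycleType_eq]
  exact ⟨fun h => (alternatingGroup α).subtype.map_isConj h,
    fun h => (isConj_of_even_mem_cycleType h.symm hk he).symm⟩

theorem stmt_9 (n : ℕ) (hn : n = 6 ∨ n = 7 ∨ n = 8)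
    (x : alternatingGroup (Fin n))
    (hx : (x : Equiv.Perm (Fin n)).cycleType = {4, 2}) :
    ∀ q : ℕ, q.Prime → q ∣ Nat.card (alternatingGroup (Fin n)) →
      q ∣ Nat.card (MulAction.orbit (ConjAct (alternatingGroup (Fin n))) x) := by
  intro q hq hdvd
  have hle : q ≤ n := by
    have h := hdvd.trans (alternatingGroup (Fin n)).card_subgroup_dvd_card
    rwa [Nat.card_perm, Nat.card_fin, hq.dvd_factorial] at h
  have hcard := AlternatingGroup.card_of_cycleType_mul_eq (Fin n) {4, 2}
  have hprod : ∏ a ∈ ({4, 2} : Multiset ℕ).toFinset,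
      (({4, 2} : Multiset ℕ).count a).factorial = 1 := by decide
  have horbit : Nat.card (MulAction.orbit (ConjAct (alternatingGroup (Fin n))) x) =
      ({g : alternatingGroup (Fin n) | (g : Equiv.Perm (Fin n)).cycleType = {4, 2}} :
        Finset (alternatingGroup (Fin n))).card := by
    rw [alternatingGroup.orbit_conjAct_eq_of_even_mem_cycleType (k := 4) (by simp [hx])
      (by decide), hx, Nat.card_coe_set_eq, ← Set.ncard_coe_finset]
    simp
  rw [hprod, ← horbit, if_pos (by rcases hn with rfl | rfl | rfl <;> decide)] at hcard
  generalize Nat.card (MulAction.orbit (ConjAct (alternatingGroup (Fin n))) x) = m at hcard ⊢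
  rcases hn with rfl | rfl | rfl <;> simp [Nat.factorial] at hcard <;>
    interval_cases q <;> first | omega | (norm_num at hq)
end

section
/- If M = S₁ × ⋯ × S_k is a minimal normal subgroup of a finite group G with each S_i isomorphic to a nonabelian simple group S, and χ ∈ Irr(S) extends to Aut(S), then the character χ × ⋯ × χ of M extends to an irreducible character of G. -/
open CategoryTheory

section TwistedTensor

variable {ι n R : Type*} [Fintype ι] [CommRing R]

/-- The matrix, on the tensor power indexed by `ι`, of the tensor product of the matrices `a j`
followed by the permutation `σ` of the tensor factors. -/
def permTensorMatrix (σ : Equiv.Perm ι) (a : ι → Matrix n n R) :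
    Matrix (ι → n) (ι → n) R :=
  Matrix.of fun f g => ∏ j, a j (f j) (g (σ j))

theorem permTensorMatrix_mul [DecidableEq ι] [Fintype n] (σ τ : Equiv.Perm ι)
    (a b : ι → Matrix n n R) :
    permTensorMatrix σ a * permTensorMatrix τ b =
      permTensorMatrix (τ * σ) (fun j => a j * b (σ j)) := by
  ext f h
  simp only [permTensorMatrix, Matrix.mul_apply, Matrix.of_apply, Equiv.Perm.mul_apply]
  rw [Finset.prod_univ_sum, Fintype.piFinset_univ,
    ← Equiv.sum_comp (Equiv.arrowCongr σ (Equiv.refl n))]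
  refine Finset.sum_congr rfl fun g _ => ?_
  rw [← Equiv.prod_comp σ (fun j => b j _ _), ← Finset.prod_mul_distrib]
  simp [Equiv.arrowCongr]

theorem permTensorMatrix_one [DecidableEq ι] [DecidableEq n] :
    permTensorMatrix (1 : Equiv.Perm ι) (fun _ => (1 : Matrix n n R)) = 1 := by
  ext f g
  by_cases h : f = g
  · subst h
    rw [Matrix.one_apply_eq]
    exact Finset.prod_eq_one fun j _ => Matrix.one_apply_eq (f j)
  · obtain ⟨j, hj⟩ := Function.ne_iff.mp h
    rw [Matrix.one_apply_ne h]
    exact Finset.prod_eq_zero (Finset.mem_univ j) (Matrix.one_apply_ne hj)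

theorem trace_permTensorMatrix_one [DecidableEq ι] [Fintype n] (a : ι → Matrix n n R) :
    (permTensorMatrix 1 a).trace = ∏ j, (a j).trace := by
  simp only [Matrix.trace, permTensorMatrix, Matrix.diag_apply, Matrix.of_apply,
    Equiv.Perm.one_apply]
  rw [Finset.prod_univ_sum, Fintype.piFinset_univ]

end TwistedTensor

section AutPi

variable {ι S : Type*} [Group S]

/-- A surjective homomorphism from a finite power of a nonabelian simple group onto that group is
an automorphism of it composed with a coordinate projection. -/
theorem MonoidHom.exists_mulAut_of_surjective_pi [Finite ι] [IsSimpleGroup S]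
    (hna : ¬ ∀ a b : S, a * b = b * a) (f : (ι → S) →* S) (hf : Function.Surjective f) :
    ∃ (i : ι) (α : MulAut S), ∀ s, f s = α (s i) := by
  classical
  have := Fintype.ofFinite ι
  let c : ι → S →* S := fun i => f.comp (MonoidHom.mulSingle (fun _ => S) i)
  have hnormal (i : ι) : (c i).range.Normal := by
    refine ⟨?_⟩
    rintro _ ⟨x, rfl⟩ g
    obtain ⟨t, rfl⟩ := hf g
    refine ⟨t i * x * (t i)⁻¹, ?_⟩
    simp only [c, MonoidHom.comp_apply, ← map_inv, ← map_mul]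
    congr 1
    ext j
    by_cases h : j = i
    · subst h; simp
    · simp [h]
  have hcomm {i j : ι} (hij : i ≠ j) (x y : S) : c i x * c j y = c j y * c i x := by
    simp only [c, MonoidHom.comp_apply, ← map_mul]
    exact congrArg f (Pi.mulSingle_commute (f := fun _ : ι => S) hij x y).eq
  obtain ⟨i, hi⟩ : ∃ i, (c i).range = ⊤ := by
    by_contra! h
    have hbot (i : ι) : (c i).range = ⊥ :=
      (hnormal i).eq_bot_or_eq_top.resolve_right (h i)
    have hf1 : f = 1 := by
      refine MonoidHom.pi_ext fun i x => ?_
      have : c i x ∈ (c i).range := ⟨x, rfl⟩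
      rw [hbot i] at this
      exact this
    obtain ⟨x, hx⟩ := exists_ne (1 : S)
    obtain ⟨t, rfl⟩ := hf x
    exact hx (by rw [hf1, MonoidHom.one_apply])
  have hsurj : Function.Surjective (c i) := MonoidHom.range_eq_top.mp hi
  have hother (j : ι) (hj : j ≠ i) (y : S) : c j y = 1 := by
    rcases (hnormal j).eq_bot_or_eq_top with h | h
    · have : c j y ∈ (c j).range := ⟨y, rfl⟩
      rw [h] at this
      exact this
    · refine absurd (fun a b => ?_) hna
      obtain ⟨x, rfl⟩ := hsurj a
      obtain ⟨z, rfl⟩ := MonoidHom.range_eq_top.mp h b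
      exact hcomm hj.symm x z
  have hinj : Function.Injective (c i) := by
    rw [← MonoidHom.ker_eq_bot_iff]
    refine (MonoidHom.normal_ker (c i)).eq_bot_or_eq_top.resolve_right fun h => ?_
    obtain ⟨x, hx⟩ := exists_ne (1 : S)
    obtain ⟨t, rfl⟩ := hsurj x
    exact hx (MonoidHom.mem_ker.mp (h ▸ Subgroup.mem_top t))
  refine ⟨i, MulEquiv.ofBijective (c i) ⟨hinj, hsurj⟩, fun s => ?_⟩
  have : f = (c i).comp (Pi.evalMonoidHom (fun _ => S) i) := by
    refine MonoidHom.pi_ext fun j x => ?_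
    by_cases h : j = i
    · subst h; simp [c]
    · have := hother j h x
      simp only [c, MonoidHom.comp_apply, MonoidHom.mulSingle_apply] at this
      simp [this, Ne.symm h]
  exact DFunLike.congr_fun this s

/-- Automorphisms of a finite power of a nonabelian simple group permute the factors. -/
theorem MulAut.exists_perm_of_pi [Finite ι] [IsSimpleGroup S]
    (hna : ¬ ∀ a b : S, a * b = b * a) (φ : MulAut (ι → S)) :
    ∃ (σ : Equiv.Perm ι) (α : ι → MulAut S), ∀ s j, φ s j = α j (s (σ j)) := by
  classical
  have key (j : ι) := MonoidHom.exists_mulAut_of_surjective_pi hna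
    ((Pi.evalMonoidHom (fun _ => S) j).comp φ.toMonoidHom)
    ((Function.surjective_eval j).comp φ.surjective)
  choose σ α h using key
  have h' (s : ι → S) (j : ι) : φ s j = α j (s (σ j)) := h j s
  have hinj : Function.Injective σ := by
    intro j l hjl
    by_contra hne
    obtain ⟨x, hx⟩ := exists_ne (1 : S)
    obtain ⟨s, hs⟩ := φ.surjective (Pi.mulSingle j x)
    have hl := h' s l
    rw [hs, Pi.mulSingle_eq_of_ne (Ne.symm hne), eq_comm, map_eq_one_iff _ (α l).injective] at hl
    have hj := h' s j
    rw [hs, Pi.mulSingle_eq_same, hjl, hl, map_one] at hj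
    exact hx hj
  exact ⟨Equiv.ofBijective σ (Finite.injective_iff_bijective.mp hinj), α, h'⟩

theorem MulAut.perm_of_pi_unique [Nontrivial S] {σ τ : Equiv.Perm ι} {α β : ι → MulAut S}
    (h : ∀ (s : ι → S) j, α j (s (σ j)) = β j (s (τ j))) : σ = τ ∧ α = β := by
  classical
  have hσ : σ = τ := by
    ext j
    by_contra hne
    obtain ⟨x, hx⟩ := exists_ne (1 : S)
    have := h (Pi.mulSingle (σ j) x) j
    rw [Pi.mulSingle_eq_same, Pi.mulSingle_eq_of_ne (Ne.symm hne), map_one,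
      map_eq_one_iff _ (α j).injective] at this
    exact hx this
  subst hσ
  refine ⟨rfl, ?_⟩
  ext j x
  exact h (fun _ => x) j

/-- The tensor power of a matrix representation of `Aut S`, as a matrix representation of the
automorphism group of a power of `S`. -/
theorem MulAut.exists_permTensor_hom [Fintype ι] [DecidableEq ι] [IsSimpleGroup S]
    (hna : ¬ ∀ a b : S, a * b = b * a) {n R : Type*} [Fintype n] [DecidableEq n] [CommRing R]
    (A : MulAut S →* Matrix n n R) :
    ∃ T : MulAut (ι → S) →* Matrix (ι → n) (ι → n) R,
      ∀ (φ : MulAut (ι → S)) (σ : Equiv.Perm ι) (α : ι → MulAut S),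
        (∀ s j, φ s j = α j (s (σ j))) → T φ = permTensorMatrix σ fun j => A (α j) := by
  choose σ α h using MulAut.exists_perm_of_pi (ι := ι) hna
  have huniq (φ : MulAut (ι → S)) (τ : Equiv.Perm ι) (β : ι → MulAut S)
      (hφ : ∀ s j, φ s j = β j (s (τ j))) :
      permTensorMatrix (σ φ) (fun j => A (α φ j)) = permTensorMatrix τ fun j => A (β j) := by
    obtain ⟨h1, h2⟩ := MulAut.perm_of_pi_unique fun s j => (h φ s j).symm.trans (hφ s j)
    rw [h1, h2]
  refine ⟨⟨⟨fun φ => permTensorMatrix (σ φ) fun j => A (α φ j), ?_⟩, fun φ ψ => ?_⟩, huniq⟩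
  · rw [huniq 1 1 (fun _ => 1) fun _ _ => rfl, map_one, permTensorMatrix_one]
  · refine (huniq (φ * ψ) (σ ψ * σ φ) (fun j => α φ j * α ψ (σ φ j)) fun s j => ?_).trans ?_
    · rw [MulAut.mul_apply, h φ, h ψ]
      rfl
    · rw [permTensorMatrix_mul]
      simp only [map_mul]

end AutPi

namespace FDRep

/-- A representation is simple if its restriction along some homomorphism is. -/
theorem simple_of_simple_res {G H : Type} [Group G] [Finite G] [Group H] [Finite H] (f : H →* G)
    (X : FDRep ℂ G) (hX : Simple ((Action.res (FGModuleCat ℂ) f).obj X)) : Simple X := by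
  rw [simple_iff_end_is_rank_one] at hX ⊢
  refine le_antisymm ?_ ?_
  · rw [← hX]
    exact LinearMap.finrank_le_finrank_of_injective
      (f := (Action.res (FGModuleCat ℂ) f).mapLinearMap ℂ)
      (Functor.map_injective (Action.res (FGModuleCat ℂ) f))
  · rw [Nat.one_le_iff_ne_zero]
    intro h
    rw [Module.finrank_zero_iff] at h
    have h1 : 𝟙 ((Action.res (FGModuleCat ℂ) f).obj X) = 0 := by
      rw [← (Action.res (FGModuleCat ℂ) f).map_id, Subsingleton.elim (𝟙 X) 0]
      rfl
    have : Nontrivial (((Action.res (FGModuleCat ℂ) f).obj X) ⟶ ((Action.res (FGModuleCat ℂ) f).obj X)) :=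
      Module.nontrivial_of_finrank_pos (R := ℂ) (by rw [hX]; exact one_pos)
    obtain ⟨u, hu⟩ := exists_ne (0 : ((Action.res (FGModuleCat ℂ) f).obj X) ⟶ ((Action.res (FGModuleCat ℂ) f).obj X))
    exact hu (by rw [← Category.id_comp u, h1, Limits.zero_comp])

/-- A representation of a power of `S` whose character is the external power of an irreducible
character is irreducible. -/
theorem simple_of_char_eq_prod {H S ι : Type} [Group H] [Finite H] [Group S] [Finite S]
    [Fintype ι] (e : H ≃* (ι → S)) (χ : FDRep ℂ S) (hχ : Simple χ) (Y : FDRep ℂ H)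
    (hY : ∀ h, Y.character h = ∏ i, χ.character (e h i)) : Simple Y := by
  classical
  have := Fintype.ofFinite S
  have := Fintype.ofFinite H
  rw [simple_iff_char_is_norm_one] at hχ ⊢
  calc ∑ h, Y.character h * Y.character h⁻¹
      = ∑ s : ι → S, ∏ i, χ.character (s i) * χ.character (s i)⁻¹ := by
        rw [← Equiv.sum_comp e.toEquiv]
        refine Finset.sum_congr rfl fun h _ => ?_
        rw [hY, hY, ← Finset.prod_mul_distrib]
        simp
    _ = ∏ _i : ι, ∑ s, χ.character s * χ.character s⁻¹ := by
        rw [Finset.prod_univ_sum, Fintype.piFinset_univ]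
    _ = Nat.card H := by
        rw [hχ, Nat.card_congr e.toEquiv]
        simp

end FDRep

theorem stmt_17 {G : Type} [Group G] [Finite G] (M : Subgroup G) [M.Normal]
    (hMbot : M ≠ ⊥) (hMmin : ∀ K : Subgroup G, K.Normal → K ≤ M → K = ⊥ ∨ K = M)
    (S : Type) [Group S] [Finite S] [IsSimpleGroup S] (hna : ¬ ∀ a b : S, a * b = b * a)
    (k : ℕ) (e : M ≃* (Fin k → S))
    (χ : FDRep ℂ S) (hχ : Simple χ)
    (hext : ∃ χA : FDRep ℂ (MulAut S),
      ∀ s : S, χA.character (MulAut.conj s) = χ.character s) :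
    ∃ X : FDRep ℂ G, Simple X ∧
      ∀ m : M, X.character (m : G) = ∏ i : Fin k, χ.character (e m i) := by
  obtain ⟨χA, hχA⟩ := hext
  let b := Module.finBasis ℂ χA
  let A : MulAut S →* Matrix _ _ ℂ :=
    (MonoidHomClass.toMonoidHom (LinearMap.toMatrixAlgEquiv b)).comp χA.ρ
  obtain ⟨T, hT⟩ := MulAut.exists_permTensor_hom (ι := Fin k) hna A
  let ρ : G →* Module.End ℂ ((Fin k → Fin (Module.finrank ℂ χA)) → ℂ) :=
    (MonoidHomClass.toMonoidHom Matrix.toLinAlgEquiv').comp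
      (T.comp ((MulAut.congr e).toMonoidHom.comp MulAut.conjNormal))
  have hchar (m : M) :
      (FDRep.of ρ).character (m : G) = ∏ i : Fin k, χ.character (e m i) := by
    have hm : T (MulAut.congr e (MulAut.conjNormal (m : G))) =
        permTensorMatrix 1 fun j => A (MulAut.conj (e m j)) := by
      refine hT _ _ _ fun s j => ?_
      have : MulAut.conjNormal (m : G) (e.symm s) = m * e.symm s * m⁻¹ := by
        ext; simp
      simp [MulAut.congr, this]
    have htr (s : S) : (A (MulAut.conj s)).trace = χ.character s := by
      rw [← hχA, FDRep.character, LinearMap.trace_eq_matrix_trace ℂ b]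
      rfl
    simp only [← htr]
    rw [← trace_permTensorMatrix_one, ← hm]
    exact Matrix.trace_toLin'_eq _
  exact ⟨FDRep.of ρ, FDRep.simple_of_simple_res M.subtype _
    (FDRep.simple_of_char_eq_prod e χ hχ _ hchar), hchar⟩
end

section
/- Let G be a finite group with a proper minimal normal subgroup N = S₁ × ⋯ × S_k, k ≥ 2, where each S_i is isomorphic to SL(2,4) or to SL(2,8). Then G contains a vanishing element x of prime power order such that |x^G| is divisible by at least three distinct primes. -/
open CategoryTheory

theorem FDRep.simple_of_isIrreducible {G : Type} [Group G] [Finite G] {V : Type} [AddCommGroup V]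
    [Module ℂ V] [FiniteDimensional ℂ V] (ρ : Representation ℂ G V) (hρ : ρ.IsIrreducible) :
    Simple (FDRep.of ρ) := by
  have : NeZero (Nat.card G : ℂ) := ⟨by exact_mod_cast Nat.card_pos.ne'⟩
  rw [FDRep.simple_iff_end_is_rank_one,
    ← Representation.IsIrreducible.finrank_intertwiningMap_self ρ]
  exact ((FDRep.forget₂HomLinearEquiv (FDRep.of ρ) (FDRep.of ρ)).symm ≪≫ₗ
    Rep.homLinearEquiv _ _).finrank_eq

theorem Representation.asAlgebraHom_ofModule' {k G M : Type*} [CommRing k] [Monoid G]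
    [AddCommGroup M] [Module k M] [Module (MonoidAlgebra k G) M]
    [IsScalarTower k (MonoidAlgebra k G) M] :
    (Representation.ofModule' (k := k) (G := G) M).asAlgebraHom = Algebra.lsmul k k M :=
  (MonoidAlgebra.lift k (M →ₗ[k] M) G).apply_symm_apply _

theorem Representation.isIrreducible_ofModule' {k G M : Type*} [Field k] [Monoid G]
    [AddCommGroup M] [Module k M] [Module (MonoidAlgebra k G) M]
    [IsScalarTower k (MonoidAlgebra k G) M] [IsSimpleModule (MonoidAlgebra k G) M] :
    (Representation.ofModule' (k := k) (G := G) M).IsIrreducible := by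
  rw [Representation.irreducible_iff_isSimpleModule_asModule]
  let ρ := Representation.ofModule' (k := k) (G := G) M
  let f : ρ.asModule ≃ₗ[MonoidAlgebra k G] M :=
    { ρ.asModuleEquiv with
      map_smul' := fun r v => by
        change ρ.asModuleEquiv (r • v) = r • ρ.asModuleEquiv v
        rw [Representation.asModuleEquiv_map_smul, Representation.asAlgebraHom_ofModule']
        rfl }
  exact IsSimpleModule.congr f

/-- If a nonzero central element `a` of the group algebra satisfies `tr (x * a) = 0` in every
representation, then some irreducible character vanishes at `x`. -/
theorem exists_simple_character_eq_zero {G : Type} [Group G] [Finite G] (x : G)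
    (a : MonoidAlgebra ℂ G) (ha : a ≠ 0) (hc : ∀ b, Commute b a)
    (h : ∀ (V : Type) [AddCommGroup V] [Module ℂ V] [FiniteDimensional ℂ V]
      (ρ : Representation ℂ G V),
      LinearMap.trace ℂ V (ρ.asAlgebraHom (MonoidAlgebra.of ℂ G x * a)) = 0) :
    ∃ V : FDRep ℂ G, Simple V ∧ V.character x = 0 := by
  have : NeZero (Nat.card G : ℂ) := ⟨by exact_mod_cast Nat.card_pos.ne'⟩
  let A := MonoidAlgebra ℂ G
  let K : Submodule A A :=
    { carrier := {v | a * v = 0}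
      zero_mem' := by simp
      add_mem' := fun {u v} hu hv => by
        simp only [Set.mem_ofPred_eq] at *
        rw [mul_add, hu, hv, add_zero]
      smul_mem' := fun b v hv => by
        simp only [Set.mem_ofPred_eq, smul_eq_mul] at *
        rw [← mul_assoc, ← (hc b).eq, mul_assoc, hv, mul_zero] }
  obtain ⟨W, hW, w, hw, haw⟩ : ∃ W : Submodule A A, IsSimpleModule A W ∧ ∃ w ∈ W, a * w ≠ 0 := by
    by_contra! hcon
    have hK : sSup {m : Submodule A A | IsSimpleModule A m} ≤ K :=
      sSup_le fun W hW w hw => hcon W hW w hw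
    rw [IsSemisimpleModule.sSup_simples_eq_top] at hK
    exact ha (by simpa [K] using hK (Submodule.mem_top (x := (1 : A))))
  have : FiniteDimensional ℂ A := inferInstance
  have : FiniteDimensional ℂ W :=
    inferInstanceAs (FiniteDimensional ℂ (W.restrictScalars ℂ))
  let ρ := Representation.ofModule' (k := ℂ) (G := G) W
  have hρ : ρ.asAlgebraHom = Algebra.lsmul ℂ ℂ W := Representation.asAlgebraHom_ofModule'
  let f : Module.End A W :=
    { toFun := fun v => a • v
      map_add' := smul_add a
      map_smul' := fun b v => by
        simp only [RingHom.id_apply, smul_smul, (hc b).eq] }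
  obtain ⟨c, hcf⟩ :=
    (IsSimpleModule.algebraMap_end_bijective_of_isAlgClosed (A := A) (V := W) ℂ).2 f
  have hac : ∀ v : W, a • v = c • v := fun v => (LinearMap.congr_fun hcf v).symm
  have hc0 : c ≠ 0 := by
    rintro rfl
    exact haw (by simpa using congrArg Subtype.val (hac ⟨w, hw⟩))
  refine ⟨FDRep.of ρ, FDRep.simple_of_isIrreducible ρ Representation.isIrreducible_ofModule', ?_⟩
  have hx : ρ.asAlgebraHom (MonoidAlgebra.of ℂ G x * a) = c • ρ x := by
    rw [map_mul, Representation.asAlgebraHom_of, hρ]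
    ext1 v
    change ρ x (a • v) = c • ρ x v
    rw [hac, map_smul]
  have htr := h W ρ
  rw [hx, map_smul, smul_eq_mul] at htr
  exact (mul_eq_zero.mp htr).resolve_left hc0

section

open Pointwise MonoidAlgebra

/-- The element `∑ m ∈ M, f (orderOf m) • m` of the group algebra. -/
noncomputable def orderSum {G : Type*} [Group G] (f : ℕ → ℂ) (M : Subgroup G) :
    MonoidAlgebra ℂ G :=
  ∑ᶠ m : M, single (m : G) (f (orderOf m))

section orderSum

variable {G : Type*} [Group G] (f : ℕ → ℂ)

theorem orderSum_eq_sum (M : Subgroup G) [Fintype M] :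
    orderSum f M = ∑ m : M, single (m : G) (f (orderOf m)) :=
  finsum_eq_sum_of_fintype _

variable [Finite G]

theorem of_mul_orderSum (g : G) (M : Subgroup G) :
    of ℂ G g * orderSum f M = orderSum f (MulAut.conj g • M) * of ℂ G g := by
  have := Fintype.ofFinite M
  have := Fintype.ofFinite (MulAut.conj g • M : Subgroup G)
  rw [orderSum_eq_sum, orderSum_eq_sum, Finset.mul_sum, Finset.sum_mul]
  refine Fintype.sum_equiv (Subgroup.equivSMul (MulAut.conj g) M).toEquiv _ _ fun m => ?_
  have hm : ((Subgroup.equivSMul (MulAut.conj g) M m : (MulAut.conj g • M : Subgroup G)) : G)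
      = g * m * g⁻¹ := rfl
  have ho : orderOf (Subgroup.equivSMul (MulAut.conj g) M m) = orderOf m :=
    MulEquiv.orderOf_eq _ _
  change of ℂ G g * single (m : G) _ =
    single ((Subgroup.equivSMul (MulAut.conj g) M m : (MulAut.conj g • M : Subgroup G)) : G)
      (f (orderOf (Subgroup.equivSMul (MulAut.conj g) M m))) * of ℂ G g
  rw [hm, ho, of_apply, single_mul_single, single_mul_single, one_mul, mul_one,
    inv_mul_cancel_right]

theorem commute_orderSum {M : Subgroup G} {b : MonoidAlgebra ℂ G}
    (h : ∀ m ∈ M, Commute (of ℂ G m) b) : Commute (orderSum f M) b := by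
  have := Fintype.ofFinite M
  rw [orderSum_eq_sum]
  refine Commute.sum_left _ _ _ fun m _ => ?_
  have : single (m : G) (f (orderOf m)) = f (orderOf m) • of ℂ G (m : G) := by
    simp
  rw [this]
  exact (h m m.2).smul_left _

theorem orderSum_commute {M K : Subgroup G} (h : ∀ m ∈ M, ∀ k ∈ K, Commute m k) :
    Commute (orderSum f M) (orderSum f K) :=
  commute_orderSum f fun m hm => (commute_orderSum f fun k hk =>
    ((h m hm k hk).symm.map (of ℂ G))).symm

theorem orderSum_mem_range {M K : Subgroup G} (h : M ≤ K) :
    orderSum f M ∈ (mapDomainRingHom ℂ K.subtype).range := by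
  have := Fintype.ofFinite M
  rw [orderSum_eq_sum]
  exact sum_mem fun m _ => ⟨single ⟨m, h m.2⟩ (f (orderOf m)), by simp⟩

theorem coeff_one_orderSum_mul {M K : Subgroup G} (h : M ⊓ K = ⊥) {b : MonoidAlgebra ℂ G}
    (hb : b ∈ (mapDomainRingHom ℂ K.subtype).range) :
    (orderSum f M * b).coeff 1 = f 1 * b.coeff 1 := by
  have := Fintype.ofFinite M
  obtain ⟨c, rfl⟩ := hb
  rw [orderSum_eq_sum, Finset.sum_mul, coeff_sum, Finsupp.finsetSum_apply,
    Finset.sum_eq_single (1 : M)]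
  · simp
  · intro m _ hm
    rw [coeff_single_mul_apply, mul_one]
    have : ((m : G)⁻¹) ∉ Set.range K.subtype := by
      rintro ⟨k, hk⟩
      apply hm
      have hmK : (m : G) ∈ K := by
        rw [← inv_mem_iff, ← hk]
        exact k.2
      have : (m : G) ∈ M ⊓ K := ⟨m.2, hmK⟩
      rw [h, Subgroup.mem_bot] at this
      exact Subtype.ext this
    rw [show (mapDomainRingHom ℂ K.subtype c).coeff (m : G)⁻¹ = 0 from
      Finsupp.mapDomain_of_notMem_range _ _ this, mul_zero]
  · simp

theorem of_mul_prod_orderSum (g : G) (L : List (Subgroup G)) :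
    of ℂ G g * (L.map (orderSum f)).prod =
      ((L.map (MulAut.conj g • ·)).map (orderSum f)).prod * of ℂ G g := by
  induction L with
  | nil => simp
  | cons M L ih =>
    simp only [List.map_cons, List.prod_cons]
    rw [← mul_assoc, of_mul_orderSum, mul_assoc, ih, mul_assoc]

theorem prod_orderSum_coeff_one (L : List (Subgroup G))
    (hL : L.Pairwise fun A B => ∀ a ∈ A, ∀ b ∈ B, Commute a b)
    (hc : ∀ A ∈ L, A ⊓ Subgroup.centralizer (A : Set G) = ⊥) :
    (L.map (orderSum f)).prod.coeff 1 = f 1 ^ L.length := by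
  induction L with
  | nil => simp [one_def]
  | cons M L ih =>
    rw [List.pairwise_cons] at hL
    rw [List.map_cons, List.prod_cons, coeff_one_orderSum_mul f (hc M (by simp)),
      ih hL.2 fun A hA => hc A (by simp [hA]), List.length_cons, pow_succ']
    refine Subring.list_prod_mem _ fun y hy => ?_
    obtain ⟨A, hA, rfl⟩ := List.mem_map.mp hy
    refine orderSum_mem_range f fun a ha => ?_
    rw [Subgroup.mem_centralizer_iff]
    exact fun m hm => hL.1 A hA m hm a ha

theorem trace_of_mul_orderSum_mul {S : Type*} [Group S] [Fintype S] (ι : S →* G)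
    (hι : Function.Injective ι) (x : S)
    (hx : ∀ τ : S → ℂ, (∀ g h, τ (g * h * g⁻¹) = τ h) → ∑ s, f (orderOf s) * τ (x * s) = 0)
    {b : MonoidAlgebra ℂ G} (hb : ∀ s, Commute (of ℂ G (ι s)) b)
    {V : Type*} [AddCommGroup V] [Module ℂ V] (ρ : Representation ℂ G V) :
    LinearMap.trace ℂ V (ρ.asAlgebraHom (of ℂ G (ι x) * (orderSum f ι.range * b))) = 0 := by
  have := Fintype.ofFinite ι.range
  let τ : S → ℂ := fun s => LinearMap.trace ℂ V (ρ.asAlgebraHom (of ℂ G (ι s) * b))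
  have hτ : ∀ g h, τ (g * h * g⁻¹) = τ h := fun g h => by
    have : of ℂ G (ι (g * h * g⁻¹)) * b = of ℂ G (ι g) * (of ℂ G (ι h) * b) * of ℂ G (ι g⁻¹) := by
      simp only [map_mul, mul_assoc]
      rw [(hb g⁻¹).eq]
    simp only [τ]
    rw [this, map_mul, LinearMap.trace_mul_comm, ← map_mul, ← mul_assoc, ← map_mul, ← map_mul,
      inv_mul_cancel, map_one, map_one, one_mul]
  rw [← hx τ hτ]
  have hsum : orderSum f ι.range = ∑ s, f (orderOf s) • of ℂ G (ι s) := by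
    rw [orderSum_eq_sum]
    refine (Fintype.sum_equiv (MonoidHom.ofInjective hι).toEquiv _ _ fun s => ?_).symm
    change _ = single (ι s) (f (orderOf (MonoidHom.ofInjective hι s)))
    rw [MulEquiv.orderOf_eq]
    simp
  rw [hsum, Finset.sum_mul, Finset.mul_sum, map_sum, map_sum]
  refine Finset.sum_congr rfl fun s _ => ?_
  rw [smul_mul_assoc, mul_smul_comm, map_smul, map_smul, smul_eq_mul, ← mul_assoc, ← map_mul,
    ← map_mul]

end orderSum

/-- If the distinct conjugates of the image of `ι : S ↪ G` centralize each other, and `S` has an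
element `x` and a function of the order orthogonal to the translates by `x` of all class
functions, then some irreducible character of `G` vanishes at `ι x`. -/
theorem exists_simple_character_eq_zero_of_orderSum {G : Type} [Group G] [Finite G] {S : Type*}
    [Group S] [Fintype S] (ι : S →* G) (hι : Function.Injective ι)
    (hcenter : Subgroup.center S = ⊥)
    (hcomm : ∀ g : G, MulAut.conj g • ι.range ≠ ι.range → ∀ m ∈ ι.range,
      ∀ k ∈ MulAut.conj g • ι.range, Commute m k)
    (x : S) (f : ℕ → ℂ) (hf : f 1 ≠ 0)
    (hx : ∀ τ : S → ℂ, (∀ g h, τ (g * h * g⁻¹) = τ h) → ∑ s, f (orderOf s) * τ (x * s) = 0) :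
    ∃ V : FDRep ℂ G, Simple V ∧ V.character (ι x) = 0 := by
  classical
  have := Fintype.ofFinite (Subgroup G)
  set M := ι.range with hM
  let T : Finset (Subgroup G) := Finset.univ.filter fun K => ∃ g : G, K = MulAut.conj g • M
  have hT : ∀ K, K ∈ T ↔ ∃ g : G, K = MulAut.conj g • M := fun K => by simp [T]
  have hsmul : ∀ g h : G, MulAut.conj g • MulAut.conj h • M = MulAut.conj (g * h) • M := by
    intro g h
    rw [map_mul, mul_smul]
  have hMT : M ∈ T := (hT M).2 ⟨1, by simp⟩
  have hTcomm : ∀ A ∈ T, ∀ B ∈ T, A ≠ B → ∀ a ∈ A, ∀ b ∈ B, Commute a b := by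
    intro A hA B hB hAB a ha b hb
    obtain ⟨g, rfl⟩ := (hT A).1 hA
    obtain ⟨h, rfl⟩ := (hT B).1 hB
    rw [Subgroup.mem_pointwise_smul_iff_inv_smul_mem] at ha
    have hb' : (MulAut.conj g)⁻¹ • b ∈ MulAut.conj (g⁻¹ * h) • M := by
      rw [← hsmul, map_inv, Subgroup.smul_mem_pointwise_smul_iff]
      exact hb
    have hne : MulAut.conj (g⁻¹ * h) • M ≠ M := by
      intro heq
      apply hAB
      conv_lhs => rw [← heq]
      rw [hsmul, mul_inv_cancel_left]
    have := (hcomm _ hne _ ha _ hb').map (MulAut.conj g).toMonoidHom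
    change Commute (MulAut.conj g • (MulAut.conj g)⁻¹ • a) (MulAut.conj g • (MulAut.conj g)⁻¹ • b)
      at this
    rwa [smul_inv_smul, smul_inv_smul] at this
  have hTcenter : ∀ A ∈ T, A ⊓ Subgroup.centralizer (A : Set G) = ⊥ := by
    intro A hA
    obtain ⟨g, rfl⟩ := (hT A).1 hA
    rw [eq_bot_iff]
    rintro a ⟨ha, hac⟩
    obtain ⟨m, ⟨s, rfl⟩, rfl⟩ := ha
    have hs : s ∈ Subgroup.center S := by
      rw [Subgroup.mem_center_iff]
      intro t
      have := Subgroup.mem_centralizer_iff.1 hac (MulAut.conj g (ι t))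
        (Subgroup.smul_mem_pointwise_smul _ _ _ ⟨t, rfl⟩)
      apply hι
      apply (MulAut.conj g).injective
      rw [map_mul, map_mul, map_mul, map_mul]
      exact this
    rw [hcenter, Subgroup.mem_bot] at hs
    simp [hs]
  let a : List (Subgroup G) → MonoidAlgebra ℂ G := fun L => (L.map (orderSum f)).prod
  have hpair : ∀ L : List (Subgroup G), L.Nodup → (∀ A ∈ L, A ∈ T) →
      L.Pairwise fun A B => ∀ a ∈ A, ∀ b ∈ B, Commute a b := fun L hL hLT =>
    hL.imp_of_mem fun hA hB hAB => hTcomm _ (hLT _ hA) _ (hLT _ hB) hAB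
  have hperm : ∀ L L' : List (Subgroup G), L.Nodup → (∀ A ∈ L, A ∈ T) → L.Perm L' →
      a L = a L' := fun L L' hL hLT hp => by
    refine (hp.map _).prod_eq' ?_
    rw [List.pairwise_map]
    exact (hpair L hL hLT).imp fun h => orderSum_commute f h
  have hnd : T.toList.Nodup := T.nodup_toList
  refine exists_simple_character_eq_zero (ι x) (a T.toList) ?_ ?_ ?_
  · intro h0
    have := prod_orderSum_coeff_one f T.toList (hpair _ hnd (by simp))
      (fun A hA => hTcenter A (by simpa using hA))
    rw [show (T.toList.map (orderSum f)).prod = 0 from h0] at this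
    exact pow_ne_zero _ hf this.symm
  · have hg : ∀ g, Commute (of ℂ G g) (a T.toList) := fun g => by
      have h1 := of_mul_prod_orderSum f g T.toList
      have hinj : Function.Injective fun K : Subgroup G => MulAut.conj g • K :=
        MulAction.injective _
      have hnd' := hnd.map hinj
      have hmem : ∀ A ∈ T.toList.map (MulAut.conj g • ·), A ∈ T := by
        intro A hA
        obtain ⟨B, hB, rfl⟩ := List.mem_map.1 hA
        obtain ⟨h, rfl⟩ := (hT B).1 (by simpa using hB)
        exact (hT _).2 ⟨g * h, hsmul g h⟩
      have hp : (T.toList.map (MulAut.conj g • ·)).Perm T.toList := by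
        refine (hnd'.subperm fun A hA => ?_).perm_of_length_le (by simp)
        simpa using hmem A hA
      have h2 := hperm _ _ hnd' hmem hp
      exact h1.trans (by rw [show (List.map (orderSum f) _).prod = _ from h2])
    intro b
    induction b using MonoidAlgebra.induction_on with
    | of m => exact hg m
    | add b c hb hc => exact hb.add_left hc
    | smul r b hb => exact hb.smul_left r
  · intro V _ _ _ ρ
    rw [hperm _ _ hnd (by simp) (List.perm_cons_erase (a := M) (by simpa using hMT))]
    refine trace_of_mul_orderSum_mul f ι hι x hx (fun s => ?_) ρ
    refine Commute.list_prod_right _ _ fun y hy => ?_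
    obtain ⟨A, hA, rfl⟩ := List.mem_map.mp hy
    rw [hnd.mem_erase_iff] at hA
    exact (commute_orderSum f fun k hk => ((hTcomm _ hMT _ (by simpa using hA.2) hA.1.symm _
      ⟨s, rfl⟩ _ hk).symm.map (of ℂ G))).symm

theorem Subgroup.relIndex_dvd_index_of_normal_right {G : Type*} [Group G] [Finite G]
    (H K : Subgroup G) [K.Normal] : H.relIndex K ∣ H.index := by
  have h1 := Subgroup.relIndex_mul_relIndex (H ⊓ K) H (H ⊔ K) inf_le_left le_sup_left
  have h2 := Subgroup.relIndex_mul_relIndex (H ⊓ K) K (H ⊔ K) inf_le_right le_sup_right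
  rw [Subgroup.inf_relIndex_left, ← Subgroup.relIndex_sup_right (K := K)] at h1
  rw [Subgroup.inf_relIndex_right, ← h1, mul_comm] at h2
  have h0 : K.relIndex (H ⊔ K) ≠ 0 := Nat.card_pos.ne'
  rw [Nat.eq_of_mul_eq_mul_left (Nat.pos_of_ne_zero h0) h2]
  exact Subgroup.relIndex_dvd_index_of_le le_sup_left

theorem Subgroup.relIndex_dvd_index_of_normal_of_normal {G : Type*} [Group G] [Finite G]
    (H : Subgroup G) {K N : Subgroup G} [N.Normal] (hKN : K ≤ N) [(K.subgroupOf N).Normal] :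
    H.relIndex K ∣ H.index := by
  rw [← Subgroup.relIndex_subgroupOf hKN]
  exact (Subgroup.relIndex_dvd_index_of_normal_right _ _).trans
    (Subgroup.relIndex_dvd_index_of_normal_right H N)

theorem card_orbit_conjAct {G : Type*} [Group G] (x : G) :
    Nat.card (MulAction.orbit (ConjAct G) x) = (Subgroup.centralizer {x}).index := by
  rw [Subgroup.centralizer_eq_comap_stabilizer]
  exact (MulAction.index_stabilizer (ConjAct G) x).symm.trans
    (Subgroup.index_comap_of_surjective _ ConjAct.toConjAct.surjective).symm

/-- An element `x` of order `p` whose class size is divisible by `q` and `r`, together with a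
function of the order orthogonal to the translates by `x` of all class functions. Over `ℂ`, the
last condition says that `x` is a zero of a sum of irreducible characters closed under the
automorphisms of `S`. -/
def HasVanishingElement (S : Type*) [Group S] [Fintype S] (p q r : ℕ) : Prop :=
  ∃ x : S, orderOf x = p ∧ q ∣ (Subgroup.centralizer {x}).index ∧
    r ∣ (Subgroup.centralizer {x}).index ∧ ∃ f : ℕ → ℂ, f 1 ≠ 0 ∧
      ∀ τ : S → ℂ, (∀ g h, τ (g * h * g⁻¹) = τ h) → ∑ s, f (orderOf s) * τ (x * s) = 0

section

variable {G : Type} [Group G] [Finite G] {N : Subgroup G} [N.Normal] {S : Type*} [Group S]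
  [IsSimpleGroup S] {ι : S →* G}

theorem commute_of_mem_conj (hMN : ι.range ≤ N)
    [(ι.range.subgroupOf N).Normal] (g : G) (hg : MulAut.conj g • ι.range ≠ ι.range) :
    ∀ m ∈ ι.range, ∀ k ∈ MulAut.conj g • ι.range, Commute m k := by
  have hM : ∀ n ∈ N, ∀ m ∈ ι.range, n * m * n⁻¹ ∈ ι.range := fun n hn m hm => by
    have := Subgroup.Normal.conj_mem (H := ι.range.subgroupOf N) inferInstance ⟨m, hMN hm⟩
      hm ⟨n, hn⟩
    exact this
  have hgN : MulAut.conj g • ι.range ≤ N := by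
    rintro _ ⟨m, hm, rfl⟩
    exact Subgroup.Normal.conj_mem inferInstance m (hMN hm) g
  have hgM : ∀ n ∈ N, ∀ m ∈ MulAut.conj g • ι.range, n * m * n⁻¹ ∈ MulAut.conj g • ι.range := by
    rintro n hn _ ⟨m, hm, rfl⟩
    have hn' : g⁻¹ * n * g ∈ N := by
      simpa using Subgroup.Normal.conj_mem (inferInstance : N.Normal) n hn g⁻¹
    refine ⟨_, hM _ hn' m hm, ?_⟩
    change g * (g⁻¹ * n * g * m * (g⁻¹ * n * g)⁻¹) * g⁻¹ = n * (g * m * g⁻¹) * n⁻¹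
    group
  have hnormal : ((MulAut.conj g • ι.range).comap ι).Normal :=
    ⟨fun s hs t => by
      simpa only [Subgroup.mem_comap, map_mul, map_inv] using hgM (ι t) (hMN ⟨t, rfl⟩) (ι s) hs⟩
  rcases hnormal.eq_bot_or_eq_top with h | h
  · intro m hm k hk
    have h1 : m * k * m⁻¹ * k⁻¹ ∈ MulAut.conj g • ι.range :=
      mul_mem (hgM m (hMN hm) k hk) (inv_mem hk)
    have h2 : m * k * m⁻¹ * k⁻¹ ∈ ι.range := by
      rw [mul_assoc m, mul_assoc m]
      exact mul_mem hm (hM k (hgN hk) _ (inv_mem hm))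
    obtain ⟨s, hs⟩ := h2
    have hs1 : s = 1 := by
      rw [← Subgroup.mem_bot, ← h, Subgroup.mem_comap, hs]
      exact h1
    rw [hs1, map_one, eq_comm, mul_inv_eq_one, mul_inv_eq_iff_eq_mul] at hs
    exact hs
  · exfalso
    apply hg
    refine (Subgroup.eq_of_le_of_card_ge ?_ ?_).symm
    · rintro _ ⟨s, rfl⟩
      have : s ∈ (MulAut.conj g • ι.range).comap ι := h ▸ Subgroup.mem_top s
      exact this
    · exact (Nat.card_congr (Subgroup.equivSMul (MulAut.conj g) ι.range).toEquiv).ge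

/-- If the index of the normalizer of the image of `S` and the class of `x` in `S` together
involve three primes, then the image of `x` has the desired properties in `G`. -/
theorem exists_vanishing_of_hasVanishingElement [Fintype S] (hι : Function.Injective ι)
    (hcenter : Subgroup.center S = ⊥) (hMN : ι.range ≤ N) [(ι.range.subgroupOf N).Normal]
    {p q r s : ℕ} (hp : p.Prime) (hS : HasVanishingElement S p q r)
    (hs : s ∣ (Subgroup.normalizer (ι.range : Set G)).index) :
    ∃ x : G, IsPrimePow (orderOf x) ∧
      (∃ V : FDRep ℂ G, Simple V ∧ V.character x = 0) ∧
      q ∣ Nat.card (MulAction.orbit (ConjAct G) x) ∧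
      r ∣ Nat.card (MulAction.orbit (ConjAct G) x) ∧
      s ∣ Nat.card (MulAction.orbit (ConjAct G) x) := by
  obtain ⟨x, hxp, hq, hr, f, hf, hτ⟩ := hS
  have hcomm := commute_of_mem_conj hMN
  have hdvd : (Subgroup.centralizer {x}).index ∣ (Subgroup.centralizer {ι x}).index := by
    have : Subgroup.centralizer {x} = (Subgroup.centralizer {ι x}).comap ι := by
      ext y
      simp only [Subgroup.mem_comap, Subgroup.mem_centralizer_iff, Set.mem_singleton_iff,
        forall_eq, ← map_mul, hι.eq_iff]
    rw [this, Subgroup.index_comap]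
    exact Subgroup.relIndex_dvd_index_of_normal_of_normal _ hMN
  have hle : Subgroup.centralizer {ι x} ≤ Subgroup.normalizer (ι.range : Set G) := by
    intro g hg
    rw [Subgroup.mem_centralizer_iff] at hg
    have hgx := hg _ rfl
    have hgM : MulAut.conj g • ι.range = ι.range := by
      by_contra hne
      have hxg : ι x ∈ MulAut.conj g • ι.range :=
        ⟨ι x, ⟨x, rfl⟩, by
          change g * ι x * g⁻¹ = ι x
          rw [← hgx, mul_inv_cancel_right]⟩
      have : x ∈ Subgroup.center S := by
        rw [Subgroup.mem_center_iff]
        intro t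
        apply hι
        rw [map_mul, map_mul]
        exact hcomm g hne _ ⟨t, rfl⟩ _ hxg
      rw [hcenter, Subgroup.mem_bot] at this
      rw [this, orderOf_one] at hxp
      exact hp.one_lt.ne hxp
    exact Subgroup.mem_normalizer_iff_map_conj_eq.2 hgM
  refine ⟨ι x, ?_, exists_simple_character_eq_zero_of_orderSum ι hι hcenter hcomm x f hf hτ,
    ?_, ?_, ?_⟩
  · rw [orderOf_injective ι hι, hxp]
    exact hp.isPrimePow
  · rw [card_orbit_conjAct]
    exact hq.trans hdvd
  · rw [card_orbit_conjAct]
    exact hr.trans hdvd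
  · rw [card_orbit_conjAct]
    exact hs.trans (Subgroup.index_dvd_of_le hle)

theorem exists_vanishing_of_minimal [Fintype S]
    (hmin : ∀ K : Subgroup G, K.Normal → K ≤ N → K = ⊥ ∨ K = N)
    (hι : Function.Injective ι)
    (hcenter : Subgroup.center S = ⊥) (hMN : ι.range < N) [(ι.range.subgroupOf N).Normal]
    {p q r : ℕ} (hp : p.Prime) (hq : q.Prime) (hr : r.Prime) (hpq : p ≠ q) (hpr : p ≠ r)
    (hqr : q ≠ r) (h₁ : HasVanishingElement S p q r) (h₂ : HasVanishingElement S q p r)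
    (h₃ : HasVanishingElement S r p q) :
    ∃ x : G, IsPrimePow (orderOf x) ∧
      (∃ V : FDRep ℂ G, Simple V ∧ V.character x = 0) ∧
      ∃ p q r : ℕ, p.Prime ∧ q.Prime ∧ r.Prime ∧ p ≠ q ∧ p ≠ r ∧ q ≠ r ∧
        p ∣ Nat.card (MulAction.orbit (ConjAct G) x) ∧
        q ∣ Nat.card (MulAction.orbit (ConjAct G) x) ∧
        r ∣ Nat.card (MulAction.orbit (ConjAct G) x) := by
  have hindex : (Subgroup.normalizer (ι.range : Set G)).index ≠ 1 := by
    intro h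
    rw [Subgroup.index_eq_one, Subgroup.normalizer_eq_top_iff] at h
    rcases hmin _ h hMN.le with h' | h'
    · rw [MonoidHom.range_eq_bot_iff] at h'
      obtain ⟨s, hs⟩ := exists_ne (1 : S)
      exact hs (hι (by rw [h']; rfl))
    · exact hMN.ne h'
  obtain ⟨s, hs, hdvd⟩ := Nat.exists_prime_and_dvd hindex
  by_cases hsp : s = p
  · subst hsp
    obtain ⟨x, hx, hV, h1, h2, h3⟩ :=
      exists_vanishing_of_hasVanishingElement hι hcenter hMN.le hp h₁ hdvd
    exact ⟨x, hx, hV, q, r, s, hq, hr, hp, hqr, hpq.symm, hpr.symm, h1, h2, h3⟩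
  by_cases hsq : s = q
  · subst hsq
    obtain ⟨x, hx, hV, h1, h2, h3⟩ :=
      exists_vanishing_of_hasVanishingElement hι hcenter hMN.le hq h₂ hdvd
    exact ⟨x, hx, hV, p, r, s, hp, hr, hq, hpr, hpq, hqr.symm, h1, h2, h3⟩
  · obtain ⟨x, hx, hV, h1, h2, h3⟩ :=
      exists_vanishing_of_hasVanishingElement hι hcenter hMN.le hr h₃ hdvd
    exact ⟨x, hx, hV, p, q, s, hp, hq, hs, hpq, Ne.symm hsp, Ne.symm hsq, h1, h2, h3⟩

end

end

section SpecialLinearGroup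

open Matrix

variable {F : Type*} [Field F]

namespace Matrix.SpecialLinearGroup

/-- The matrix in `SL(2, F)` with the given entries, in characteristic two. -/
def mkTwo [CharP F 2] (a b c d : F) (h : a * d + b * c = 1) : SpecialLinearGroup (Fin 2) F :=
  ⟨!![a, b; c, d], by rw [det_fin_two_of, CharTwo.sub_eq_add, h]⟩

/-- The companion matrix of `X ^ 2 + t * X + 1`, in characteristic two. -/
def companionTwo [CharP F 2] (t : F) : SpecialLinearGroup (Fin 2) F :=
  mkTwo 0 1 1 t (by simp)

theorem eq_one_iff_entries (m : SpecialLinearGroup (Fin 2) F) :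
    m = 1 ↔ m 0 0 = 1 ∧ m 0 1 = 0 ∧ m 1 0 = 0 ∧ m 1 1 = 1 := by
  simp [SpecialLinearGroup.ext_iff, Fin.forall_fin_two, and_assoc]

theorem entries_mul_add_mul [CharP F 2] (m : SpecialLinearGroup (Fin 2) F) :
    m 0 0 * m 1 1 + m 0 1 * m 1 0 = 1 := by
  have := m.det_coe
  rwa [det_fin_two, CharTwo.sub_eq_add] at this

theorem trace_conj (g m : SpecialLinearGroup (Fin 2) F) :
    trace (g * m * g⁻¹ : SpecialLinearGroup (Fin 2) F).1 = trace m.1 := by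
  rw [coe_mul, trace_mul_comm, ← coe_mul, ← mul_assoc, inv_mul_cancel, one_mul]

theorem sum_eq_sum_entries [CharP F 2] [Fintype F] [DecidableEq F] {A : Type*} [AddCommMonoid A]
    (h : F → F → F → F → A) :
    ∑ m : SpecialLinearGroup (Fin 2) F, h (m 0 0) (m 0 1) (m 1 0) (m 1 1) =
      ∑ a, ∑ b, ∑ c, ∑ d, if a * d + b * c = 1 then h a b c d else 0 := by
  simp only [← Fintype.sum_prod_type']
  rw [← Finset.sum_filter]
  refine Finset.sum_bij' (fun m _ => (m 0 0, m 0 1, m 1 0, m 1 1))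
    (fun u hu => mkTwo u.1 u.2.1 u.2.2.1 u.2.2.2 (Finset.mem_filter.1 hu).2) ?_ ?_ ?_ ?_ ?_
  · intro m _
    simpa using entries_mul_add_mul m
  · simp
  · intro m _
    ext i j
    fin_cases i <;> fin_cases j <;> rfl
  · intro u _
    rfl
  · intro m _
    rfl

theorem mul_companion_eq_of_det_eq_one [CharP F 2] {a b c d : F} (h : a * d + b * c = 1) (x y : F) :
    !![a, b; c, d] * !![x, a * x + b * y; y, c * x + d * y] =
      !![x, a * x + b * y; y, c * x + d * y] * !![0, 1; 1, a + d] := by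
  have h2 : (2 : F) = 0 := CharTwo.two_eq_zero
  rw [Matrix.mul_fin_two, Matrix.mul_fin_two]
  ext i j
  fin_cases i <;> fin_cases j <;> simp
  · linear_combination (-x) * h + (b * c * x - x) * h2
  · linear_combination (-y) * h + (b * c * y - y) * h2

theorem isConj_companionTwo [CharP F 2] [Finite F] {m : SpecialLinearGroup (Fin 2) F}
    (hm : m ≠ 1) : ∃ g, m = g * companionTwo (trace m.1) * g⁻¹ := by
  have hdet := entries_mul_add_mul m
  suffices ∃ x y : F, x * (m 1 0 * x + m 1 1 * y) + (m 0 0 * x + m 0 1 * y) * y = 1 by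
    obtain ⟨x, y, h⟩ := this
    refine ⟨mkTwo x (m 0 0 * x + m 0 1 * y) y (m 1 0 * x + m 1 1 * y) h, ?_⟩
    rw [eq_mul_inv_iff_mul_eq]
    apply Subtype.ext
    rw [coe_mul, coe_mul, mkTwo, companionTwo, mkTwo, trace_fin_two]
    exact (congrArg (· * _) (Matrix.eta_fin_two m.1)).trans (mul_companion_eq_of_det_eq_one hdet x y)
  have hsqrt : ∀ a : F, a ≠ 0 → ∃ x, a * x ^ 2 = 1 := by
    intro a ha
    obtain ⟨x, hx⟩ := isSquare_of_charTwo' a⁻¹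
    exact ⟨x, by rw [sq, ← hx, mul_inv_cancel₀ ha]⟩
  by_cases hc : m 1 0 = 0
  · by_cases hb : m 0 1 = 0
    · have had : m 0 0 + m 1 1 ≠ 0 := by
        intro h
        apply hm
        rw [CharTwo.add_eq_zero] at h
        rw [hb, zero_mul, add_zero, ← h, ← sq] at hdet
        have h1 : m 0 0 = 1 := by
          rw [← CharTwo.add_eq_zero, ← pow_eq_zero_iff two_ne_zero, CharTwo.add_sq, hdet, one_pow,
            CharTwo.add_self_eq_zero]
        exact (eq_one_iff_entries m).2 ⟨h1, hb, hc, h ▸ h1⟩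
      refine ⟨1, (m 0 0 + m 1 1)⁻¹, ?_⟩
      rw [hb, hc]
      field_simp
      ring
    · obtain ⟨y, hy⟩ := hsqrt _ hb
      exact ⟨0, y, by linear_combination hy⟩
  · obtain ⟨x, hx⟩ := hsqrt _ hc
    exact ⟨x, 0, by linear_combination hx⟩

theorem center_eq_bot_of_charTwo [CharP F 2] :
    Subgroup.center (SpecialLinearGroup (Fin 2) F) = ⊥ := by
  rw [eq_bot_iff]
  intro m hm
  rw [mem_center_iff] at hm
  obtain ⟨r, hr, hrm⟩ := hm
  have h1 : r = 1 := by
    rw [Fintype.card_fin] at hr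
    rw [← CharTwo.add_eq_zero, ← pow_eq_zero_iff two_ne_zero, CharTwo.add_sq, hr, one_pow,
      CharTwo.add_self_eq_zero]
  rw [Subgroup.mem_bot]
  apply Subtype.ext
  rw [← hrm, h1, map_one, coe_one]

theorem isSimpleGroup_of_charTwo [CharP F 2] [Finite F] (hF : 4 ≤ Nat.card F) :
    IsSimpleGroup (SpecialLinearGroup (Fin 2) F) := by
  have := Matrix.ProjectiveSpecialLinearGroup.rank_two_simple hF
  have e : ProjectiveSpecialLinearGroup (Fin 2) F ≃* SpecialLinearGroup (Fin 2) F :=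
    (QuotientGroup.quotientMulEquivOfEq center_eq_bot_of_charTwo).trans QuotientGroup.quotientBot
  exact e.isSimpleGroup_congr.mp this

variable [CharP F 2]

theorem companionTwo_ne_one (t : F) : companionTwo t ≠ 1 := fun h =>
  one_ne_zero ((eq_one_iff_entries _).1 h).2.1

theorem orderOf_eq_of_ne_one [Finite F] {m : SpecialLinearGroup (Fin 2) F} (hm : m ≠ 1) :
    orderOf m = orderOf (companionTwo (trace m.1)) := by
  obtain ⟨g, hg⟩ := isConj_companionTwo hm
  conv_lhs => rw [hg]
  exact MulEquiv.orderOf_eq (MulAut.conj g) _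

theorem trace_companionTwo_mul (t : F) (m : SpecialLinearGroup (Fin 2) F) :
    trace (companionTwo t * m).1 = m 1 0 + (m 0 1 + t * m 1 1) := by
  rw [coe_mul, companionTwo, mkTwo, trace_fin_two]
  simp [Matrix.mul_apply, Fin.sum_univ_two]

theorem trace_companionTwo (t : F) : trace (companionTwo t).1 = t := by
  rw [companionTwo, mkTwo, trace_fin_two]
  simp

variable [Fintype F] [DecidableEq F]

theorem index_centralizer_companionTwo (t : F) :
    (Subgroup.centralizer {companionTwo t}).index =
      ∑ a : F, ∑ b : F, ∑ c : F, ∑ d : F, if a * d + b * c = 1 then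
        if a + d = t ∧ ¬(a = 1 ∧ b = 0 ∧ c = 0 ∧ d = 1) then 1 else 0 else 0 := by
  rw [← sum_eq_sum_entries fun a b c d =>
    if a + d = t ∧ ¬(a = 1 ∧ b = 0 ∧ c = 0 ∧ d = 1) then 1 else 0, ← card_orbit_conjAct,
    ← Finset.card_filter, ← Fintype.card_subtype, ← Nat.card_eq_fintype_card]
  refine Nat.card_congr (Equiv.subtypeEquivRight fun m => ?_)
  rw [ConjAct.mem_orbit_conjAct, isConj_comm, isConj_iff, ← eq_one_iff_entries, ← trace_fin_two]
  constructor
  · rintro ⟨g, rfl⟩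
    refine ⟨(trace_conj _ _).trans (trace_companionTwo t), fun h => companionTwo_ne_one t ?_⟩
    rwa [mul_inv_eq_one, mul_eq_left] at h
  · rintro ⟨rfl, hm⟩
    obtain ⟨g, hg⟩ := isConj_companionTwo hm
    exact ⟨g, hg.symm⟩

theorem hasVanishingElement_of_sum_eq_zero {o : F → ℕ}
    (ho : ∀ t : F, orderOf (companionTwo t) = o t) (t₀ : F) {f : ℕ → ℤ} {n : ℕ} (hf : f 1 ≠ 0) (hft : f (o t₀) = 0)
    (hn : (∑ a : F, ∑ b : F, ∑ c : F, ∑ d : F, if a * d + b * c = 1 then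
      if a + d = t₀ ∧ ¬(a = 1 ∧ b = 0 ∧ c = 0 ∧ d = 1) then 1 else 0 else 0) = n)
    (hsum : ∀ t : F, (∑ a : F, ∑ b : F, ∑ c : F, ∑ d : F, if a * d + b * c = 1 then
      if c + (b + t₀ * d) = t then
        if a = 1 ∧ b = 0 ∧ c = 0 ∧ d = 1 then f 1 else f (o (a + d)) else 0 else 0) = 0)
    {q r : ℕ} (hq : q ∣ n) (hr : r ∣ n) :
    HasVanishingElement (SpecialLinearGroup (Fin 2) F) (o t₀) q r := by
  rw [← index_centralizer_companionTwo] at hn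
  refine ⟨companionTwo t₀, ho t₀, hn ▸ hq, hn ▸ hr, fun k => f k, Int.cast_ne_zero.2 hf, ?_⟩
  intro τ hτ
  have hterm : ∀ s : SpecialLinearGroup (Fin 2) F,
      (f (orderOf s) : ℂ) * τ (companionTwo t₀ * s) =
        ∑ t : F, (if trace (companionTwo t₀ * s).1 = t then (f (orderOf s) : ℂ) else 0) *
          τ (companionTwo t) := by
    intro s
    simp only [ite_mul, zero_mul]
    rw [Finset.sum_ite_eq, if_pos (Finset.mem_univ _)]
    by_cases hs : companionTwo t₀ * s = 1
    · rw [← inv_eq_of_mul_eq_one_right hs, orderOf_inv, ho, hft]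
      simp
    · obtain ⟨g, hg⟩ := isConj_companionTwo hs
      conv_lhs => rw [hg, hτ]
  have horder : ∀ s : SpecialLinearGroup (Fin 2) F, f (orderOf s) =
      if s 0 0 = 1 ∧ s 0 1 = 0 ∧ s 1 0 = 0 ∧ s 1 1 = 1 then f 1
      else f (o (s 0 0 + s 1 1)) := by
    intro s
    split_ifs with h
    · rw [(eq_one_iff_entries s).2 h, orderOf_one]
    · rw [orderOf_eq_of_ne_one (mt (eq_one_iff_entries s).1 h), ho, trace_fin_two]
  rw [Finset.sum_congr rfl fun s _ => hterm s, Finset.sum_comm]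
  refine Finset.sum_eq_zero fun t _ => ?_
  have h := hsum t
  rw [← sum_eq_sum_entries fun a b c d => if c + (b + t₀ * d) = t then
    if a = 1 ∧ b = 0 ∧ c = 0 ∧ d = 1 then f 1 else f (o (a + d)) else 0] at h
  simp only [← horder, ← trace_companionTwo_mul] at h
  rw [← Finset.sum_mul]
  have h' := congrArg (Int.cast (R := ℂ)) h
  push_cast at h'
  rw [h', zero_mul]

end Matrix.SpecialLinearGroup

end SpecialLinearGroup

section

open Matrix.SpecialLinearGroup
open scoped MatrixGroups

/-- The function of the order taking the values `a`, `b`, `c`, `d` at the identity, the involutions,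
the other elements of order dividing `k`, and the remaining elements. For `k = q - 1` and `q` even,
these are the values of the sums of Galois conjugate characters of `SL(2, q)`. -/
def valueByOrder (k : ℕ) (a b c d : ℤ) (n : ℕ) : ℤ :=
  if n = 1 then a else if n = 2 then b else if n ∣ k then c else d

/-- The field with four elements, as `𝔽₂[X] / (X ^ 2 + X + 1)`. -/
def GF4 : Type := Bool × Bool

namespace GF4

instance : DecidableEq GF4 := inferInstanceAs (DecidableEq (Bool × Bool))

instance : Fintype GF4 := inferInstanceAs (Fintype (Bool × Bool))

instance : Zero GF4 := ⟨(false, false)⟩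

instance : One GF4 := ⟨(true, false)⟩

instance : Add GF4 := ⟨fun a b => (a.1 ^^ b.1, a.2 ^^ b.2)⟩

instance : Neg GF4 := ⟨id⟩

instance : Mul GF4 := ⟨fun a b =>
  ((a.1 && b.1) ^^ (a.2 && b.2), (a.1 && b.2) ^^ (a.2 && b.1) ^^ (a.2 && b.2))⟩

instance : Field GF4 where
  inv a := a * a
  nsmul := nsmulRec
  zsmul := zsmulRec
  nnqsmul := _
  qsmul := _
  add_assoc := by decide +kernel
  zero_add := by decide +kernel
  add_zero := by decide +kernel
  add_comm := by decide +kernel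
  neg_add_cancel := by decide +kernel
  mul_assoc := by decide +kernel
  one_mul := by decide +kernel
  mul_one := by decide +kernel
  mul_comm := by decide +kernel
  left_distrib := by decide +kernel
  right_distrib := by decide +kernel
  zero_mul := by decide +kernel
  mul_zero := by decide +kernel
  exists_pair_ne := by decide +kernel
  mul_inv_cancel := by decide +kernel
  inv_zero := by decide +kernel

instance : CharP GF4 2 :=
  CharTwo.of_one_ne_zero_of_two_eq_zero (by decide +kernel) (by decide +kernel)

theorem natCard : Nat.card GF4 = 2 ^ 2 := by
  rw [Nat.card_eq_fintype_card]
  rfl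

/-- The order of the companion matrix of `X ^ 2 + t * X + 1`. -/
def companionOrder (t : GF4) : ℕ :=
  if t = 0 then 2 else if t = 1 then 3 else 5

theorem orderOf_companionTwo (t : GF4) : orderOf (companionTwo t) = companionOrder t := by
  have h : ∀ t : GF4, 0 < companionOrder t ∧ companionTwo t ^ companionOrder t = 1 ∧
      ∀ m < companionOrder t, 0 < m → companionTwo t ^ m ≠ 1 := by
    decide +kernel
  exact (orderOf_eq_iff (h t).1).2 (h t).2

theorem hasVanishingElement_two : HasVanishingElement SL(2, GF4) 2 3 5 :=
  hasVanishingElement_of_sum_eq_zero (f := valueByOrder 3 4 0 1 (-1)) (n := 15)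
    orderOf_companionTwo 0 (by decide) (by decide +kernel) (by decide +kernel)
    (by decide +kernel) (by decide) (by decide)

theorem hasVanishingElement_three : HasVanishingElement SL(2, GF4) 3 2 5 :=
  hasVanishingElement_of_sum_eq_zero (f := valueByOrder 3 6 (-2) 0 1) (n := 20)
    orderOf_companionTwo 1 (by decide) (by decide +kernel) (by decide +kernel)
    (by decide +kernel) (by decide) (by decide)

theorem hasVanishingElement_five : HasVanishingElement SL(2, GF4) 5 2 3 :=
  hasVanishingElement_of_sum_eq_zero (f := valueByOrder 3 5 1 (-1) 0) (n := 12)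
    orderOf_companionTwo (false, true) (by decide) (by decide +kernel) (by decide +kernel)
    (by decide +kernel) (by decide) (by decide)

end GF4

/-- The field with eight elements, as `𝔽₂[X] / (X ^ 3 + X + 1)`. -/
def GF8 : Type := Bool × Bool × Bool

namespace GF8

instance : DecidableEq GF8 := inferInstanceAs (DecidableEq (Bool × Bool × Bool))

instance : Fintype GF8 := inferInstanceAs (Fintype (Bool × Bool × Bool))

instance : Zero GF8 := ⟨(false, false, false)⟩

instance : One GF8 := ⟨(true, false, false)⟩

instance : Add GF8 := ⟨fun a b => (a.1 ^^ b.1, a.2.1 ^^ b.2.1, a.2.2 ^^ b.2.2)⟩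

instance : Neg GF8 := ⟨id⟩

instance : Mul GF8 := ⟨fun a b =>
  ((a.1 && b.1) ^^ (a.2.1 && b.2.2) ^^ (a.2.2 && b.2.1),
    (a.1 && b.2.1) ^^ (a.2.1 && b.1) ^^ (a.2.1 && b.2.2) ^^ (a.2.2 && b.2.1) ^^ (a.2.2 && b.2.2),
    (a.1 && b.2.2) ^^ (a.2.1 && b.2.1) ^^ (a.2.2 && b.1) ^^ (a.2.2 && b.2.2))⟩

instance : Field GF8 where
  inv a := a * a * (a * a) * (a * a)
  nsmul := nsmulRec
  zsmul := zsmulRec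
  nnqsmul := _
  qsmul := _
  add_assoc := by decide +kernel
  zero_add := by decide +kernel
  add_zero := by decide +kernel
  add_comm := by decide +kernel
  neg_add_cancel := by decide +kernel
  mul_assoc := by decide +kernel
  one_mul := by decide +kernel
  mul_one := by decide +kernel
  mul_comm := by decide +kernel
  left_distrib := by decide +kernel
  right_distrib := by decide +kernel
  zero_mul := by decide +kernel
  mul_zero := by decide +kernel
  exists_pair_ne := by decide +kernel
  mul_inv_cancel := by decide +kernel
  inv_zero := by decide +kernel

instance : CharP GF8 2 :=
  CharTwo.of_one_ne_zero_of_two_eq_zero (by decide +kernel) (by decide +kernel)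

theorem natCard : Nat.card GF8 = 2 ^ 3 := by
  rw [Nat.card_eq_fintype_card]
  rfl

/-- The order of the companion matrix of `X ^ 2 + t * X + 1`. -/
def companionOrder (t : GF8) : ℕ :=
  if t = 0 then 2 else if t = 1 then 3 else if (t⁻¹).1 then 9 else 7

theorem orderOf_companionTwo (t : GF8) : orderOf (companionTwo t) = companionOrder t := by
  have h : ∀ t : GF8, 0 < companionOrder t ∧ companionTwo t ^ companionOrder t = 1 ∧
      ∀ m < companionOrder t, 0 < m → companionTwo t ^ m ≠ 1 := by
    decide +kernel
  exact (orderOf_eq_iff (h t).1).2 (h t).2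

theorem hasVanishingElement_two : HasVanishingElement SL(2, GF8) 2 3 7 :=
  hasVanishingElement_of_sum_eq_zero (f := valueByOrder 7 8 0 1 (-1)) (n := 63)
    orderOf_companionTwo 0 (by decide) (by decide +kernel) (by decide +kernel)
    (by decide +kernel) (by decide) (by decide)

theorem hasVanishingElement_three : HasVanishingElement SL(2, GF8) 3 2 7 :=
  hasVanishingElement_of_sum_eq_zero (f := valueByOrder 7 27 3 (-1) 0) (n := 56)
    orderOf_companionTwo 1 (by decide) (by decide +kernel) (by decide +kernel)
    (by decide +kernel) (by decide) (by decide)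

theorem hasVanishingElement_seven : HasVanishingElement SL(2, GF8) 7 2 3 :=
  hasVanishingElement_of_sum_eq_zero (f := valueByOrder 7 28 (-4) 0 1) (n := 72)
    orderOf_companionTwo (true, false, true) (by decide) (by decide +kernel) (by decide +kernel)
    (by decide +kernel) (by decide) (by decide)

end GF8

end

section

variable {G : Type} [Group G] [Finite G]

theorem exists_vanishing_of_mulEquiv_pi {N : Subgroup G} [N.Normal]
    (hmin : ∀ K : Subgroup G, K.Normal → K ≤ N → K = ⊥ ∨ K = N) {I : Type*} [DecidableEq I]
    {S : I → Type*} [∀ i, Group (S i)] (e : N ≃* ((i : I) → S i)) {i j : I} (hij : i ≠ j)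
    [Nontrivial (S j)] {T : Type*} [Group T] [Fintype T] [IsSimpleGroup T]
    (hcenter : Subgroup.center T = ⊥) (φ : T ≃* S i)
    {p q r : ℕ} (hp : p.Prime) (hq : q.Prime) (hr : r.Prime) (hpq : p ≠ q) (hpr : p ≠ r)
    (hqr : q ≠ r) (h₁ : HasVanishingElement T p q r) (h₂ : HasVanishingElement T q p r)
    (h₃ : HasVanishingElement T r p q) :
    ∃ x : G, IsPrimePow (orderOf x) ∧
      (∃ V : FDRep ℂ G, Simple V ∧ V.character x = 0) ∧
      ∃ p q r : ℕ, p.Prime ∧ q.Prime ∧ r.Prime ∧ p ≠ q ∧ p ≠ r ∧ q ≠ r ∧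
        p ∣ Nat.card (MulAction.orbit (ConjAct G) x) ∧
        q ∣ Nat.card (MulAction.orbit (ConjAct G) x) ∧
        r ∣ Nat.card (MulAction.orbit (ConjAct G) x) := by
  let κ : T →* N := e.symm.toMonoidHom.comp ((MonoidHom.mulSingle S i).comp φ.toMonoidHom)
  have hκ : ∀ t, e (κ t) = Pi.mulSingle i (φ t) := fun t => e.apply_symm_apply _
  let ι : T →* G := N.subtype.comp κ
  have hι : Function.Injective ι := N.subtype_injective.comp
    (e.symm.injective.comp ((Pi.mulSingle_injective i).comp φ.injective))
  have hmem : ∀ n : N, (n : G) ∈ ι.range ↔ ∀ l, l ≠ i → e n l = 1 := by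
    intro n
    constructor
    · rintro ⟨t, ht⟩ l hl
      rw [← Subtype.ext (show ((κ t : N) : G) = n from ht), hκ, Pi.mulSingle_eq_of_ne hl]
    · intro h
      refine ⟨φ.symm (e n i), congrArg Subtype.val (e.injective ?_ : κ _ = n)⟩
      rw [hκ, φ.apply_symm_apply]
      ext l
      by_cases hl : l = i
      · subst hl
        rw [Pi.mulSingle_eq_same]
      · rw [Pi.mulSingle_eq_of_ne hl, h l hl]
  have hMN : ι.range ≤ N := by
    rintro _ ⟨t, rfl⟩
    exact (κ t).2
  have hlt : ι.range < N := by
    refine lt_of_le_of_ne hMN fun h => ?_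
    obtain ⟨s, hs⟩ := exists_ne (1 : S j)
    have hs' : (e.symm (Pi.mulSingle j s) : G) ∈ ι.range := by
      rw [h]
      exact SetLike.coe_mem _
    have := (hmem _).1 hs' j hij.symm
    rw [e.apply_symm_apply, Pi.mulSingle_eq_same] at this
    exact hs this
  have hnormal : (ι.range.subgroupOf N).Normal := by
    refine ⟨fun n hn g => ?_⟩
    rw [Subgroup.mem_subgroupOf, hmem] at hn ⊢
    intro l hl
    rw [map_mul, map_mul, Pi.mul_apply, Pi.mul_apply, hn l hl, mul_one, ← Pi.mul_apply, ← map_mul,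
      mul_inv_cancel, map_one, Pi.one_apply]
  exact exists_vanishing_of_minimal hmin hι hcenter hlt hp hq hr hpq hpr hqr h₁ h₂ h₃

end

theorem nonempty_specialLinearGroup_mulEquiv {K L : Type*} [Field K] [Finite K] [Field L] [Finite L]
    (h : Nat.card K = Nat.card L) (n : Type*) [Fintype n] [DecidableEq n] :
    Nonempty (Matrix.SpecialLinearGroup n K ≃* Matrix.SpecialLinearGroup n L) := by
  have := Fintype.ofFinite K
  have := Fintype.ofFinite L
  rw [Nat.card_eq_fintype_card, Nat.card_eq_fintype_card] at h
  let ψ : K ≃+* L := FiniteField.ringEquivOfCardEq h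
  refine ⟨MonoidHom.toMulEquiv (Matrix.SpecialLinearGroup.map ψ.toRingHom)
    (Matrix.SpecialLinearGroup.map ψ.symm.toRingHom) ?_ ?_⟩ <;>
  · ext m i j
    simp

theorem stmt_19 {G : Type} [Group G] [Finite G] (N : Subgroup G) [N.Normal]
    (hproper : N ≠ ⊤) (hbot : N ≠ ⊥)
    (hmin : ∀ K : Subgroup G, K.Normal → K ≤ N → K = ⊥ ∨ K = N)
    (k : ℕ) (hk : 2 ≤ k) (S : Fin k → Subgroup G)
    (hS : ∀ i, Nonempty ((S i) ≃* Matrix.SpecialLinearGroup (Fin 2) (GaloisField 2 2)) ∨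
      Nonempty ((S i) ≃* Matrix.SpecialLinearGroup (Fin 2) (GaloisField 2 3)))
    (e : N ≃* ((i : Fin k) → S i)) :
    ∃ x : G, IsPrimePow (orderOf x) ∧
      (∃ V : FDRep ℂ G, Simple V ∧ V.character x = 0) ∧
      ∃ p q r : ℕ, p.Prime ∧ q.Prime ∧ r.Prime ∧ p ≠ q ∧ p ≠ r ∧ q ≠ r ∧
        p ∣ Nat.card (MulAction.orbit (ConjAct G) x) ∧
        q ∣ Nat.card (MulAction.orbit (ConjAct G) x) ∧
        r ∣ Nat.card (MulAction.orbit (ConjAct G) x) := by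
  have : IsSimpleGroup (Matrix.SpecialLinearGroup (Fin 2) GF4) :=
    Matrix.SpecialLinearGroup.isSimpleGroup_of_charTwo (by rw [GF4.natCard]; norm_num)
  have : IsSimpleGroup (Matrix.SpecialLinearGroup (Fin 2) GF8) :=
    Matrix.SpecialLinearGroup.isSimpleGroup_of_charTwo (by rw [GF8.natCard]; norm_num)
  obtain ⟨ψ₄⟩ := nonempty_specialLinearGroup_mulEquiv
    (GF4.natCard.trans (GaloisField.card 2 2 two_ne_zero).symm) (Fin 2)
  obtain ⟨ψ₈⟩ := nonempty_specialLinearGroup_mulEquiv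
    (GF8.natCard.trans (GaloisField.card 2 3 three_ne_zero).symm) (Fin 2)
  obtain ⟨i, j, hij⟩ : ∃ i j : Fin k, i ≠ j := ⟨⟨0, by lia⟩, ⟨1, by lia⟩, by simp⟩
  have : Nontrivial (S j) := (hS j).elim (fun ⟨φ⟩ => (φ.trans ψ₄.symm).toEquiv.nontrivial)
    (fun ⟨φ⟩ => (φ.trans ψ₈.symm).toEquiv.nontrivial)
  rcases hS i with ⟨⟨φ⟩⟩ | ⟨⟨φ⟩⟩
  · exact exists_vanishing_of_mulEquiv_pi hmin e hij
      Matrix.SpecialLinearGroup.center_eq_bot_of_charTwo (ψ₄.trans φ.symm)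
      Nat.prime_two Nat.prime_three Nat.prime_five (by decide) (by decide) (by decide)
      GF4.hasVanishingElement_two GF4.hasVanishingElement_three GF4.hasVanishingElement_five
  · exact exists_vanishing_of_mulEquiv_pi hmin e hij
      Matrix.SpecialLinearGroup.center_eq_bot_of_charTwo (ψ₈.trans φ.symm)
      Nat.prime_two Nat.prime_three Nat.prime_seven (by decide) (by decide) (by decide)
      GF8.hasVanishingElement_two GF8.hasVanishingElement_three GF8.hasVanishingElement_seven
end
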